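/- arXiv:0809.3438 — 2 statements merged into one kernel-verified Lean document; each statement's English description precedes it below -/
import Mathlib

section
/- Let φ : 𝔻 → 𝔻 be holomorphic. Then the composition operator C_φ is an isometry on the Bloch space of 𝔻 if and only if φ(0) = 0 and either φ ∈ Aut(𝔻) or there exists a sequence {S_k} in Aut(𝔻) such that |S_k(0)| → 1 and φ∘S_k converges to the identity map uniformly on compact subsets of 𝔻. -/
open Complex Metric Set Filter

/-- The set of values `(1-|z|²)|f'(z)|` for `z` in the unit disk. -/
def blochValues (f : ℂ → ℂ) : Set ℝ :=
  {r : ℝ | ∃ z ∈ ball (0 : ℂ) 1, r = (1 - ‖z‖ ^ 2) * ‖deriv f z‖}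

/-- The Bloch seminorm `β_f = sup_{z ∈ 𝔻} (1-|z|²)|f'(z)|`. -/
noncomputable def blochSemi (f : ℂ → ℂ) : ℝ := sSup (blochValues f)

/-- `f` is a Bloch function on the unit disk: it is holomorphic there and its
Bloch seminorm is finite. -/
def IsBlochFn (f : ℂ → ℂ) : Prop :=
  DifferentiableOn ℂ f (ball (0 : ℂ) 1) ∧ BddAbove (blochValues f)

/-- The Bloch norm `‖f‖_B = |f(0)| + β_f`. -/
noncomputable def blochNorm (f : ℂ → ℂ) : ℝ := ‖f 0‖ + blochSemi f

/-- The composition operator `C_φ` is an isometry on the Bloch space of `𝔻`. -/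
def IsIsometryCompOp (φ : ℂ → ℂ) : Prop :=
  ∀ f : ℂ → ℂ, IsBlochFn f → IsBlochFn (f ∘ φ) ∧ blochNorm (f ∘ φ) = blochNorm f

/-- `φ` is an automorphism of the unit disk: a biholomorphic bijection of `𝔻`
onto itself. -/
def IsDiskAut (φ : ℂ → ℂ) : Prop :=
  DifferentiableOn ℂ φ (ball (0 : ℂ) 1) ∧
  BijOn φ (ball (0 : ℂ) 1) (ball (0 : ℂ) 1) ∧
  ∃ ψ : ℂ → ℂ, DifferentiableOn ℂ ψ (ball (0 : ℂ) 1) ∧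
    InvOn ψ φ (ball (0 : ℂ) 1) (ball (0 : ℂ) 1)

open ComplexConjugate in
/-- The disk automorphism sending `0` to `a`. -/
noncomputable def mob (a z : ℂ) : ℂ := (z + a) / (1 + conj a * z)

open ComplexConjugate in
lemma mob_den {a z : ℂ} (ha : ‖a‖ < 1) (hz : ‖z‖ < 1) : 1 + conj a * z ≠ 0 := by
  intro h
  have h1 : conj a * z = -1 := by linear_combination h
  have h2 : ‖conj a * z‖ = 1 := by rw [h1]; simp
  rw [norm_mul, RCLike.norm_conj] at h2
  nlinarith [norm_nonneg a, norm_nonneg z]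

lemma mob_lt {a z : ℂ} (ha : ‖a‖ < 1) (hz : ‖z‖ < 1) : ‖mob a z‖ < 1 := by
  have hd := mob_den ha hz
  unfold mob
  rw [norm_div, div_lt_one (norm_pos_iff.2 hd)]
  apply lt_of_pow_lt_pow_left₀ 2 (norm_nonneg _)
  have ha2 : ‖a‖ ^ 2 < 1 := by nlinarith [norm_nonneg a]
  have hz2 : ‖z‖ ^ 2 < 1 := by nlinarith [norm_nonneg z]
  rw [← Complex.normSq_eq_norm_sq] at ha2 hz2
  rw [← Complex.normSq_eq_norm_sq, ← Complex.normSq_eq_norm_sq]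
  simp only [Complex.normSq_apply, Complex.add_re, Complex.add_im, Complex.mul_re, Complex.mul_im,
    Complex.conj_re, Complex.conj_im, Complex.one_re, Complex.one_im] at *
  nlinarith [mul_pos (sub_pos.2 ha2) (sub_pos.2 hz2)]

lemma mob_inv {a z : ℂ} (ha : ‖a‖ < 1) (hz : ‖z‖ < 1) : mob (-a) (mob a z) = z := by
  have hd := mob_den ha hz
  have hd2 := mob_den (a := -a) (by simpa using ha) (mob_lt ha hz)
  have hd3 := mob_den (a := -a) (z := a) (by simpa using ha) ha
  unfold mob at *
  have e1 : (z + a) / (1 + starRingEnd ℂ a * z) + -a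
      = z * (1 + starRingEnd ℂ (-a) * a) / (1 + starRingEnd ℂ a * z) := by
    rw [eq_div_iff hd, add_mul, div_mul_cancel₀ _ hd, map_neg]; ring
  have e2 : 1 + starRingEnd ℂ (-a) * ((z + a) / (1 + starRingEnd ℂ a * z))
      = (1 + starRingEnd ℂ (-a) * a) / (1 + starRingEnd ℂ a * z) := by
    rw [eq_div_iff hd, add_mul, mul_assoc, div_mul_cancel₀ _ hd, map_neg]; ring
  rw [div_eq_iff hd2, e1, e2, mul_div_assoc]

lemma mob_zero (a : ℂ) : mob a 0 = a := by simp [mob]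

lemma mob_neg_self (a : ℂ) : mob (-a) a = 0 := by simp [mob]

lemma mob_diff {a : ℂ} (ha : ‖a‖ < 1) : DifferentiableOn ℂ (mob a) (ball 0 1) := by
  intro z hz
  have hd := mob_den ha (mem_ball_zero_iff.1 hz)
  unfold mob
  apply DifferentiableAt.differentiableWithinAt
  fun_prop (disch := assumption)

lemma mob_hasDerivAt_zero (a : ℂ) : HasDerivAt (mob a) ((1 - ‖a‖ ^ 2 : ℝ) : ℂ) 0 := by
  unfold mob
  have h1 := ((hasDerivAt_id (0:ℂ)).add_const a)
  have h2 := (((hasDerivAt_id (0:ℂ)).const_mul (starRingEnd ℂ a)).const_add 1)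
  have h3 := Complex.mul_conj' a
  refine (h1.fun_div h2 (by simp)).congr_deriv ?_
  push_cast
  rw [← h3]
  simp

lemma mob_hasDerivAt_neg {a : ℂ} (ha : ‖a‖ < 1) :
    HasDerivAt (mob (-a)) ((1 - ‖a‖ ^ 2 : ℝ) : ℂ)⁻¹ a := by
  unfold mob
  have h1 := ((hasDerivAt_id a).add_const (-a))
  have h2 := (((hasDerivAt_id a).const_mul (starRingEnd ℂ (-a))).const_add 1)
  have hd := mob_den (a := -a) (z := a) (by simpa using ha) ha
  refine (h1.fun_div h2 hd).congr_deriv ?_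
  have h3 := Complex.mul_conj' a
  have h4 : ((1 - ‖a‖ ^ 2 : ℝ) : ℂ) = 1 + (starRingEnd ℂ (-a)) * a := by
    push_cast; rw [← h3, map_neg]; ring
  rw [h4]
  simp only [id, mul_one, one_mul, add_neg_cancel, zero_mul, sub_zero]
  field_simp

lemma mob_maps {a : ℂ} (ha : ‖a‖ < 1) : MapsTo (mob a) (ball 0 1) (ball 0 1) := fun z hz =>
  mem_ball_zero_iff.2 (mob_lt ha (mem_ball_zero_iff.1 hz))

lemma one_sub_pos {z : ℂ} (hz : z ∈ ball (0:ℂ) 1) : 0 < 1 - ‖z‖ ^ 2 := by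
  have := mem_ball_zero_iff.1 hz
  nlinarith [norm_nonneg z]

/-- derivative of `φ ∘ mob a` at zero -/
lemma deriv_comp_mob {φ : ℂ → ℂ} (hφ : DifferentiableOn ℂ φ (ball (0 : ℂ) 1)) {z : ℂ}
    (hz : z ∈ ball (0:ℂ) 1) :
    HasDerivAt (φ ∘ mob z) (deriv φ z * ((1 - ‖z‖ ^ 2 : ℝ) : ℂ)) 0 := by
  have h1 : HasDerivAt φ (deriv φ z) (mob z 0) := by
    rw [mob_zero]
    exact (hφ.differentiableAt (isOpen_ball.mem_nhds hz)).hasDerivAt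
  exact h1.comp 0 (mob_hasDerivAt_zero z)

/-- Schwarz-Pick -/
lemma schwarz_pick {φ : ℂ → ℂ} (hmap : MapsTo φ (ball (0 : ℂ) 1) (ball (0 : ℂ) 1))
    (hφ : DifferentiableOn ℂ φ (ball (0 : ℂ) 1)) {z : ℂ} (hz : z ∈ ball (0:ℂ) 1) :
    (1 - ‖z‖ ^ 2) * ‖deriv φ z‖ ≤ 1 - ‖φ z‖ ^ 2 := by
  have hz1 := mem_ball_zero_iff.1 hz
  have hb := mem_ball_zero_iff.1 (hmap hz)
  have hb' : ‖-φ z‖ < 1 := by simpa using hb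
  have hm : MapsTo (mob (-φ z) ∘ (φ ∘ mob z)) (ball 0 1) (ball 0 1) :=
    (mob_maps hb').comp (hmap.comp (mob_maps hz1))
  have hd : DifferentiableOn ℂ (mob (-φ z) ∘ (φ ∘ mob z)) (ball 0 1) :=
    (mob_diff hb').comp (hφ.comp (mob_diff hz1) (mob_maps hz1)) (hmap.comp (mob_maps hz1))
  have h0 : (mob (-φ z) ∘ (φ ∘ mob z)) 0 = 0 := by
    simp [mob_zero, mob_neg_self]
  have hder : HasDerivAt (mob (-φ z) ∘ (φ ∘ mob z)) 
      (((1 - ‖φ z‖ ^ 2 : ℝ) : ℂ)⁻¹ * (deriv φ z * ((1 - ‖z‖ ^ 2 : ℝ) : ℂ))) 0 := by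
    refine HasDerivAt.comp 0 ?_ (deriv_comp_mob hφ hz)
    simp only [Function.comp, mob_zero]
    exact mob_hasDerivAt_neg hb
  have := norm_deriv_le_one_of_mapsTo_ball hd
    (by rw [h0]; exact hm.mono_right ball_subset_closedBall) one_pos
  rw [hder.deriv, norm_mul, norm_inv, norm_mul, Complex.norm_real, Complex.norm_real,
    Real.norm_of_nonneg (one_sub_pos hz).le, Real.norm_of_nonneg (one_sub_pos (hmap hz)).le,
    inv_mul_le_iff₀ (one_sub_pos (hmap hz))] at this
  linarith

lemma value_comp_le {φ f : ℂ → ℂ} (hmap : MapsTo φ (ball (0 : ℂ) 1) (ball (0 : ℂ) 1))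
    (hφ : DifferentiableOn ℂ φ (ball (0 : ℂ) 1)) (hf : IsBlochFn f) {z : ℂ}
    (hz : z ∈ ball (0:ℂ) 1) :
    (1 - ‖z‖ ^ 2) * ‖deriv (f ∘ φ) z‖ ≤ blochSemi f := by
  rw [deriv_comp z (hf.1.differentiableAt (isOpen_ball.mem_nhds (hmap hz)))
    (hφ.differentiableAt (isOpen_ball.mem_nhds hz)), norm_mul]
  have h1 := schwarz_pick hmap hφ hz
  have h2 : (1 - ‖φ z‖ ^ 2) * ‖deriv f (φ z)‖ ≤ blochSemi f := le_csSup hf.2 ⟨_, hmap hz, rfl⟩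
  nlinarith [mul_le_mul_of_nonneg_right h1 (norm_nonneg (deriv f (φ z)))]

lemma blochValues_nonempty (f : ℂ → ℂ) : (blochValues f).Nonempty :=
  ⟨_, 0, by simp, rfl⟩

lemma comp_bloch {φ f : ℂ → ℂ} (hmap : MapsTo φ (ball (0 : ℂ) 1) (ball (0 : ℂ) 1))
    (hφ : DifferentiableOn ℂ φ (ball (0 : ℂ) 1)) (hf : IsBlochFn f) :
    IsBlochFn (f ∘ φ) ∧ blochSemi (f ∘ φ) ≤ blochSemi f := by
  refine ⟨⟨hf.1.comp hφ hmap, blochSemi f, ?_⟩, csSup_le (blochValues_nonempty _) ?_⟩ <;>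
  · rintro r ⟨z, hz, rfl⟩
    exact value_comp_le hmap hφ hf hz

/-- if `f ∘ φ ∘ S_k → f` then seminorm is at least -/
lemma semi_ge_of_approx {φ f : ℂ → ℂ} (hmap : MapsTo φ (ball (0 : ℂ) 1) (ball (0 : ℂ) 1))
    (hφ : DifferentiableOn ℂ φ (ball (0 : ℂ) 1)) (hf : IsBlochFn f) (S : ℕ → ℂ → ℂ)
    (hS : ∀ k, IsDiskAut (S k)) 
    (hK : ∀ K ⊆ ball (0 : ℂ) 1, IsCompact K → TendstoUniformlyOn (fun k => φ ∘ S k) id atTop K) :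
    blochSemi f ≤ blochSemi (f ∘ φ) := by
  apply csSup_le (blochValues_nonempty _)
  rintro r ⟨w, hw, rfl⟩
  have hbl := (comp_bloch hmap hφ hf).1
  have hdk : ∀ k, DifferentiableOn ℂ (φ ∘ S k) (ball 0 1) := fun k =>
    hφ.comp (hS k).1 (hS k).2.1.mapsTo
  have hmk : ∀ k, MapsTo (φ ∘ S k) (ball 0 1) (ball 0 1) := fun k =>
    hmap.comp (hS k).2.1.mapsTo
  have hlu : TendstoLocallyUniformlyOn (fun k => φ ∘ S k) id atTop (ball 0 1) :=
    (tendstoLocallyUniformlyOn_iff_forall_isCompact isOpen_ball).2 hK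
  have h1 : Tendsto (fun k => (φ ∘ S k) w) atTop (nhds w) := hlu.tendsto_at hw
  have h2 : Tendsto (fun k => deriv (φ ∘ S k) w) atTop (nhds 1) := by
    have := (hlu.deriv (Eventually.of_forall hdk) isOpen_ball).tendsto_at hw
    simpa using this
  have h3 : ContinuousAt (deriv f) w :=
    ((hf.1.deriv isOpen_ball).differentiableAt (isOpen_ball.mem_nhds hw)).continuousAt
  have h4 : Tendsto (fun k => (1 - ‖w‖ ^ 2) * ‖deriv f ((φ ∘ S k) w) * deriv (φ ∘ S k) w‖) atTop
      (nhds ((1 - ‖w‖ ^ 2) * ‖deriv f w * 1‖)) :=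
    (((h3.tendsto.comp h1).mul h2).norm).const_mul _
  rw [mul_one] at h4
  refine le_of_tendsto h4 (Eventually.of_forall fun k => ?_)
  rw [← deriv_comp w (hf.1.differentiableAt (isOpen_ball.mem_nhds (hmk k hw)))
    ((hdk k).differentiableAt (isOpen_ball.mem_nhds hw))]
  exact value_comp_le (f := f ∘ φ) (hS k).2.1.mapsTo (hS k).1 hbl hw

lemma semi_congr {f g : ℂ → ℂ} (h : EqOn f g (ball 0 1)) : blochSemi f = blochSemi g := by
  have : blochValues f = blochValues g := by
    ext r
    refine exists_congr fun z => and_congr_right fun hz => ?_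
    rw [(h.eventuallyEq_of_mem (isOpen_ball.mem_nhds hz)).deriv_eq]
  rw [blochSemi, this, blochSemi]

lemma semi_ge_of_aut {φ f : ℂ → ℂ} (hmap : MapsTo φ (ball (0 : ℂ) 1) (ball (0 : ℂ) 1))
    (hφ : DifferentiableOn ℂ φ (ball (0 : ℂ) 1)) (hf : IsBlochFn f) (h : IsDiskAut φ) :
    blochSemi f ≤ blochSemi (f ∘ φ) := by
  obtain ⟨-, hb, ψ, hψ, hinv⟩ := h
  have hm : MapsTo ψ (ball 0 1) (ball 0 1) := by
    intro z hz
    obtain ⟨w, hw, rfl⟩ := hb.surjOn hz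
    rw [hinv.1 hw]; exact hw
  have := (comp_bloch hm hψ (comp_bloch hmap hφ hf).1).2
  rwa [semi_congr (f := (f ∘ φ) ∘ ψ) (g := f)] at this
  intro z hz
  simp [hinv.2 hz]

lemma isDiskAut_mob {a c : ℂ} (ha : ‖a‖ < 1) (hc : ‖c‖ = 1) :
    IsDiskAut (fun z => mob a (c * z)) := by
  have hc0 : c ≠ 0 := by rintro rfl; simp at hc
  have hmul : MapsTo (fun z => c * z) (ball (0:ℂ) 1) (ball 0 1) := by
    intro z hz; simpa [hc] using hz
  have hmul' : MapsTo (fun z => c⁻¹ * z) (ball (0:ℂ) 1) (ball 0 1) := by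
    intro z hz; simpa [hc] using hz
  have ha' : ‖-a‖ < 1 := by simpa using ha
  have hinv : InvOn (fun z => c⁻¹ * mob (-a) z) (fun z => mob a (c * z)) (ball 0 1) (ball 0 1) := by
    constructor
    · intro z hz
      simp only
      rw [mob_inv ha (mem_ball_zero_iff.1 (hmul hz))]
      field_simp
    · intro z hz
      simp only
      rw [mul_inv_cancel_left₀ hc0]
      have := mob_inv ha' (mem_ball_zero_iff.1 hz)
      rwa [neg_neg] at this
  have hm := (mob_maps ha).comp hmul
  have hm' := hmul'.comp (mob_maps ha')
  exact ⟨(mob_diff ha).comp (by fun_prop) hmul, hinv.bijOn hm hm', _, (mob_diff ha').const_mul _, hinv⟩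

lemma aut_congr {f g : ℂ → ℂ} (h : EqOn f g (ball 0 1)) (hg : IsDiskAut g) : IsDiskAut f := by
  obtain ⟨h1, h2, ψ, h3, h4, h5⟩ := hg
  refine ⟨h1.congr h, h2.congr h.symm, ψ, h3, ?_, ?_⟩
  · intro z hz; rw [h hz]; exact h4 hz
  · intro z hz
    obtain ⟨w, hw, rfl⟩ := h2.surjOn hz
    rw [h4 hw]; exact h hw

/-- `c * mob a z` is an automorphism -/
lemma isDiskAut_mob' {a c : ℂ} (ha : ‖a‖ < 1) (hc : ‖c‖ = 1) :
    IsDiskAut (fun z => c * mob a z) := by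
  have hc0 : c ≠ 0 := by rintro rfl; simp at hc
  have : (fun z => c * mob a z) = fun z => mob (c * a) (c * z) := by
    ext z
    have h3 := Complex.mul_conj' c
    rw [hc] at h3
    simp only [mob, map_mul]
    rw [show starRingEnd ℂ c * starRingEnd ℂ a * (c * z)
      = (c * starRingEnd ℂ c) * (starRingEnd ℂ a * z) by ring, h3]
    simp; ring
  rw [this]
  exact isDiskAut_mob (by simpa [hc] using ha) hc

/-- attained supremum gives automorphism -/
lemma aut_of_attained {φ : ℂ → ℂ} (hmap : MapsTo φ (ball (0 : ℂ) 1) (ball (0 : ℂ) 1))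
    (hφ : DifferentiableOn ℂ φ (ball (0 : ℂ) 1)) {z : ℂ} (hz : z ∈ ball (0:ℂ) 1)
    (h : 1 ≤ (1 - ‖z‖ ^ 2) * ‖deriv φ z‖) : IsDiskAut φ := by
  have hz1 := mem_ball_zero_iff.1 hz
  have hz1' : ‖-z‖ < 1 := by simpa using hz1
  have hsp := schwarz_pick hmap hφ hz
  have hφz : φ z = 0 := by
    have : ‖φ z‖ ^ 2 = 0 := le_antisymm (by linarith) (sq_nonneg _)
    simpa using this
  have heq : (1 - ‖z‖ ^ 2) * ‖deriv φ z‖ = 1 := by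
    apply le_antisymm _ h
    simpa [hφz] using hsp
  have h0 : (φ ∘ mob z) 0 = 0 := by simp [mob_zero, hφz]
  have hder := deriv_comp_mob hφ hz
  obtain ⟨C, hC, hCe⟩ := affine_of_mapsTo_ball_of_exists_norm_dslope_eq_div' (R₂ := 1)
    (hφ.comp (mob_diff hz1) (mob_maps hz1)) 
    (by rw [h0]; exact (hmap.comp (mob_maps hz1)).mono_right ball_subset_closedBall)
    ⟨0, mem_ball_self one_pos, by
      rw [dslope_same, hder.deriv, norm_mul, Complex.norm_real,
        Real.norm_of_nonneg (one_sub_pos hz).le]; linarith⟩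
  refine aut_congr (g := fun w => C * mob (-z) w) ?_ (isDiskAut_mob' hz1' (by simpa using hC))
  intro w hw
  have h1 := hCe (mob_maps hz1' hw)
  have h2 := mob_inv hz1' (mem_ball_zero_iff.1 hw)
  rw [neg_neg] at h2
  simp only [Function.comp, h2, mob_zero, hφz, zero_add, sub_zero, smul_eq_mul] at h1
  rw [h1, mul_comm]

/-- quantitative estimate -/
lemma near_id {g : ℂ → ℂ} (hm : MapsTo g (ball (0 : ℂ) 1) (ball (0 : ℂ) 1))
    (hd : DifferentiableOn ℂ g (ball (0 : ℂ) 1)) {ε r : ℝ} (hε : 0 < ε) (h0 : ‖g 0‖ ≤ ε)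
    (h1 : ‖deriv g 0 - 1‖ ≤ ε) (hr1 : r < 1) {z : ℂ} (hz : ‖z‖ ≤ r) :
    ‖g z - z‖ ≤ 5 * ε / (1 - r) := by
  have hr : 0 ≤ r := (norm_nonneg _).trans hz
  have hzb : z ∈ ball (0:ℂ) 1 := mem_ball_zero_iff.2 (hz.trans_lt hr1)
  have hq : DifferentiableOn ℂ (fun w => dslope g 0 w - 1) (ball 0 1) :=
    ((Complex.differentiableOn_dslope (isOpen_ball.mem_nhds (mem_ball_self one_pos))).2 hd).sub_const _
  have hmq : MapsTo (fun w => dslope g 0 w - 1) (ball 0 1) {w | w.re ≤ ε} := by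
    intro w hw
    have := norm_dslope_le_div_of_mapsTo_ball (R₂ := 1 + ε) hd (by
      intro u hu
      rw [mem_closedBall, dist_eq_norm]
      have := mem_ball_zero_iff.1 (hm hu)
      linarith [norm_sub_le (g u) (g 0)]) hw
    have h2 := Complex.re_le_norm (dslope g 0 w)
    simp
    linarith
  have hbc := borelCaratheodory hε hq hmq one_pos hzb
  simp only [dslope_same] at hbc
  have e : g z - z = g 0 + z * (dslope g 0 z - 1) := by
    have := sub_smul_dslope g 0 z
    simp at this
    linear_combination -this
  have hpos : 0 < 1 - r := by linarith
  have hpos' : 0 < 1 - ‖z‖ := by linarith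
  have hb2 : ‖dslope g 0 z - 1‖ ≤ 4 * ε / (1 - r) := by
    refine hbc.trans ?_
    rw [← add_div]
    apply div_le_div₀ (by positivity) _ hpos (by linarith)
    nlinarith [norm_nonneg z, norm_nonneg (deriv g 0 - 1)]
  rw [e]
  calc _ ≤ ‖g 0‖ + ‖z‖ * ‖dslope g 0 z - 1‖ := by
        rw [← norm_mul]; exact norm_add_le _ _
    _ ≤ ε / (1 - r) + 1 * (4 * ε / (1 - r)) := by
        have : ε ≤ ε / (1 - r) := by rw [le_div_iff₀ hpos]; nlinarith
        have : ‖z‖ ≤ 1 := by linarith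
        gcongr
        linarith
    _ = _ := by ring

lemma id_bloch : IsBlochFn id ∧ blochSemi id = 1 := by
  have hle : ∀ r ∈ blochValues id, r ≤ 1 := by
    rintro r ⟨z, hz, rfl⟩
    simp
  have hb : BddAbove (blochValues id) := ⟨1, hle⟩
  refine ⟨⟨differentiableOn_id, hb⟩, le_antisymm (csSup_le (blochValues_nonempty _) hle) ?_⟩
  exact le_csSup hb ⟨0, by simp, by simp⟩

lemma exists_near {φ : ℂ → ℂ} (hφ : DifferentiableOn ℂ φ (ball (0 : ℂ) 1))
    (hs : blochSemi φ = 1) (hlt : ∀ z ∈ ball (0:ℂ) 1, (1 - ‖z‖ ^ 2) * ‖deriv φ z‖ < 1)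
    {δ : ℝ} (hδ : 0 < δ) (hδ1 : δ ≤ 1) :
    ∃ z ∈ ball (0:ℂ) 1, 1 - δ < (1 - ‖z‖ ^ 2) * ‖deriv φ z‖ ∧ 1 - δ < ‖z‖ := by
  have hsub : closedBall (0:ℂ) (1 - δ) ⊆ ball 0 1 := closedBall_subset_ball (by linarith)
  have hcont : ContinuousOn (fun z => (1 - ‖z‖ ^ 2) * ‖deriv φ z‖) (closedBall (0:ℂ) (1 - δ)) := by
    have := ((hφ.deriv isOpen_ball).continuousOn.mono hsub).norm
    exact ContinuousOn.mul (by fun_prop) this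
  obtain ⟨w, hw, hmax⟩ := (isCompact_closedBall (0:ℂ) (1 - δ)).exists_isMaxOn
    ⟨0, by simpa using hδ1⟩ hcont
  obtain ⟨_, ⟨z, hz, rfl⟩, hz2⟩ := exists_lt_of_lt_csSup (blochValues_nonempty φ)
    (b := max ((1 - ‖w‖ ^ 2) * ‖deriv φ w‖) (1 - δ)) (by
      change _ < blochSemi φ
      rw [hs]; exact max_lt (hlt w (hsub hw)) (by linarith))
  refine ⟨z, hz, (le_max_right _ _).trans_lt hz2, ?_⟩
  by_contra hcon
  have : z ∈ closedBall (0:ℂ) (1 - δ) := mem_closedBall_zero_iff.2 (not_lt.1 hcon)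
  exact absurd (hmax this) (not_le.2 ((le_max_left _ _).trans_lt hz2))

lemma step {φ : ℂ → ℂ} (hmap : MapsTo φ (ball (0 : ℂ) 1) (ball (0 : ℂ) 1))
    (hφ : DifferentiableOn ℂ φ (ball (0 : ℂ) 1))
    (hs : blochSemi φ = 1) (hlt : ∀ z ∈ ball (0:ℂ) 1, (1 - ‖z‖ ^ 2) * ‖deriv φ z‖ < 1)
    {δ : ℝ} (hδ : 0 < δ) (hδ1 : δ ≤ 1) :
    ∃ S : ℂ → ℂ, IsDiskAut S ∧ 1 - δ ≤ ‖S 0‖ ∧ ‖S 0‖ ≤ 1 ∧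
      ∀ r < 1, ∀ z : ℂ, ‖z‖ ≤ r → ‖φ (S z) - z‖ ≤ 5 * √δ / (1 - r) := by
  obtain ⟨a, ha, hv, han⟩ := exists_near hφ hs hlt hδ hδ1
  have ha1 := mem_ball_zero_iff.1 ha
  have hder := deriv_comp_mob hφ ha
  set d := deriv φ a * ((1 - ‖a‖ ^ 2 : ℝ) : ℂ) with hd
  have hdn : ‖d‖ = (1 - ‖a‖ ^ 2) * ‖deriv φ a‖ := by
    rw [hd, norm_mul, Complex.norm_real, Real.norm_of_nonneg (one_sub_pos ha).le, mul_comm]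
  have hsp := schwarz_pick hmap hφ ha
  rw [← hdn] at hv hsp
  have hd0 : 0 < ‖d‖ := by linarith
  have hd0' : (‖d‖ : ℂ) ≠ 0 := by exact_mod_cast hd0.ne'
  have hsq : √δ ^ 2 = δ := Real.sq_sqrt hδ.le
  have hs0 : 0 < √δ := Real.sqrt_pos.2 hδ
  have hs1 : √δ ≤ 1 := Real.sqrt_le_one.2 hδ1
  obtain ⟨c, hc, hcd⟩ : ∃ c : ℂ, ‖c‖ = 1 ∧ d * c = (‖d‖ : ℂ) := by
    refine ⟨starRingEnd ℂ d / ‖d‖, ?_, ?_⟩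
    · rw [norm_div, RCLike.norm_conj, Complex.norm_real, norm_norm, div_self hd0.ne']
    · rw [← mul_div_assoc, Complex.mul_conj', div_eq_iff hd0', sq]
  have haut := isDiskAut_mob ha1 hc
  refine ⟨fun z => mob a (c * z), haut, by simpa [mob_zero] using han.le,
    by simpa [mob_zero] using ha1.le, ?_⟩
  intro r hr z hz
  have hder2 : HasDerivAt (φ ∘ fun z => mob a (c * z)) (d * c) 0 := by
    have h1 : HasDerivAt (fun z : ℂ => c * z) c 0 := by
      simpa using (hasDerivAt_id (0:ℂ)).const_mul c
    have h2 : HasDerivAt (φ ∘ mob a) d (c * 0) := by rwa [mul_zero]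
    exact h2.comp 0 h1
  refine near_id (g := φ ∘ fun z => mob a (c * z)) (hmap.comp haut.2.1.mapsTo)
    (hφ.comp haut.1 haut.2.1.mapsTo) hs0 ?_ ?_ hr hz
  · simp only [Function.comp, mul_zero, mob_zero]
    apply Real.le_sqrt_of_sq_le
    linarith
  · rw [hder2.deriv, hcd]
    have : (‖d‖ : ℂ) - 1 = ((‖d‖ - 1 : ℝ) : ℂ) := by push_cast; rfl
    rw [this, Complex.norm_real, Real.norm_eq_abs, abs_le]
    constructor
    · nlinarith
    · nlinarith [sq_nonneg ‖φ a‖]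

lemma sub_const_bloch (c : ℂ) : IsBlochFn (fun z => z - c) := by
  refine ⟨by fun_prop, 1, ?_⟩
  rintro r ⟨z, hz, rfl⟩
  simp

/-- `C_φ` is an isometry on the Bloch space of the unit disk iff `φ(0) = 0` and
either `φ` is an automorphism of `𝔻`, or there is a sequence `S_k` of
automorphisms of `𝔻` with `|S_k(0)| → 1` such that `φ ∘ S_k` tends to the
identity uniformly on compact subsets of `𝔻`. -/
theorem isometry_iff_fixes_zero_and_aut_or_approx_identity
    (φ : ℂ → ℂ) (hmap : MapsTo φ (ball (0 : ℂ) 1) (ball (0 : ℂ) 1))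
    (hφ : DifferentiableOn ℂ φ (ball (0 : ℂ) 1)) :
    IsIsometryCompOp φ ↔
      (φ 0 = 0 ∧ (IsDiskAut φ ∨
        ∃ S : ℕ → ℂ → ℂ, (∀ k, IsDiskAut (S k)) ∧
          Tendsto (fun k => ‖S k 0‖) atTop (nhds 1) ∧
          ∀ K ⊆ ball (0 : ℂ) 1, IsCompact K →
            TendstoUniformlyOn (fun k => φ ∘ S k) id atTop K)) := by
  constructor
  · intro h
    have h0 : φ 0 = 0 := by
      have hb := sub_const_bloch (φ 0)
      have h1 := (h _ hb).2
      have h2 := (comp_bloch hmap hφ hb).2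
      simp only [blochNorm, Function.comp, sub_self, norm_zero, zero_sub, norm_neg] at h1
      have h3 : ‖φ 0‖ ≤ 0 := by
        linarith
      simpa using h3
    refine ⟨h0, or_iff_not_imp_left.2 fun hna => ?_⟩
    have hs : blochSemi φ = 1 := by
      have := (h id id_bloch.1).2
      simpa [blochNorm, h0, id_bloch.2] using this
    have hlt : ∀ z ∈ ball (0:ℂ) 1, (1 - ‖z‖ ^ 2) * ‖deriv φ z‖ < 1 := by
      intro z hz
      by_contra hcon
      exact hna (aut_of_attained hmap hφ hz (not_lt.1 hcon))
    have hδ0 : ∀ n : ℕ, (0:ℝ) < 1 / ((n:ℝ) + 1) := fun n => Nat.one_div_pos_of_nat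
    have hδ1 : ∀ n : ℕ, 1 / ((n:ℝ) + 1) ≤ 1 := fun n => by
      rw [div_le_one (by positivity)]; linarith [Nat.cast_nonneg (α := ℝ) n]
    have hlim : Tendsto (fun n : ℕ => 1 / ((n:ℝ) + 1)) atTop (nhds 0) :=
      tendsto_one_div_add_atTop_nhds_zero_nat
    choose S hS1 hS2 hS3 hS4 using fun n : ℕ => step hmap hφ hs hlt (hδ0 n) (hδ1 n)
    refine ⟨S, hS1, ?_, ?_⟩
    · refine tendsto_of_tendsto_of_tendsto_of_le_of_le ?_ tendsto_const_nhds hS2 hS3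
      simpa using hlim.const_sub 1
    · intro K hK hKc
      obtain ⟨r, hr, hKr⟩ := exists_lt_subset_ball hKc.isClosed hK
      rw [Metric.tendstoUniformlyOn_iff]
      intro ε hε
      have hlim2 : Tendsto (fun n : ℕ => 5 * √(1 / ((n:ℝ) + 1)) / (1 - r)) atTop (nhds 0) := by
        have := ((Real.continuous_sqrt.tendsto 0).comp hlim).const_mul 5 |>.div_const (1 - r)
        simpa using this
      filter_upwards [hlim2.eventually_lt_const hε] with n hn z hz
      rw [dist_comm, dist_eq_norm]
      exact (hS4 n r hr z (mem_ball_zero_iff.1 (hKr hz)).le).trans_lt hn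
  · rintro ⟨h0, h⟩ f hf
    have hc := comp_bloch hmap hφ hf
    refine ⟨hc.1, ?_⟩
    have hge : blochSemi f ≤ blochSemi (f ∘ φ) := by
      rcases h with h | ⟨S, hS, -, hK⟩
      · exact semi_ge_of_aut hmap hφ hf h
      · exact semi_ge_of_approx hmap hφ hf S hS hK
    simp only [blochNorm, Function.comp_apply, h0]
    rw [le_antisymm hc.2 hge]
end

section
/- Let τ be a permutation of {1,…,n} of order α, let φ : 𝔻ⁿ → 𝔻ⁿ be given by φ(z) = (z_{τ(1)},…,z_{τ(n)}), and let μ ∈ ℂ. Then the following are equivalent: (i) for every Bloch function g on 𝔻ⁿ there exists a unique Bloch function f on 𝔻ⁿ with f∘φ − μf = g; (ii) μ^α ≠ 1. In particular, when μ^α = 1 there exists a Bloch function g on 𝔻ⁿ such that no Bloch f satisfies f∘φ − μf = g. -/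
open Complex Metric Set

/-- The unit polydisk `𝔻ⁿ = { z ∈ ℂⁿ : |z_k| < 1 for all k }`. -/
def polydisk (n : ℕ) : Set (Fin n → ℂ) := {z | ∀ k, ‖z k‖ < 1}

/-- The Bergman metric on the polydisk: `H_z(u,ū) = Σ_k |u_k|²/(1−|z_k|²)²`. -/
noncomputable def polyH (n : ℕ) (z u : Fin n → ℂ) : ℝ :=
  ∑ k, ‖u k‖ ^ 2 / (1 - ‖z k‖ ^ 2) ^ 2

/-- `Q_f(z) = sup_{u ≠ 0} |f'(z)u| / H_z(u,ū)^{1/2}` on the polydisk. -/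
noncomputable def Qpoly (n : ℕ) (f : (Fin n → ℂ) → ℂ) (z : Fin n → ℂ) : ℝ :=
  sSup {r : ℝ | ∃ u : Fin n → ℂ, u ≠ 0 ∧
    r = ‖fderiv ℂ f z u‖ / Real.sqrt (polyH n z u)}

/-- The set of values `Q_f(z)` for `z ∈ 𝔻ⁿ`. -/
def blochValuesPoly (n : ℕ) (f : (Fin n → ℂ) → ℂ) : Set ℝ :=
  {r : ℝ | ∃ z ∈ polydisk n, r = Qpoly n f z}

/-- The Bloch seminorm `β_f = sup_{z ∈ 𝔻ⁿ} Q_f(z)`. -/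
noncomputable def blochSemiPoly (n : ℕ) (f : (Fin n → ℂ) → ℂ) : ℝ :=
  sSup (blochValuesPoly n f)

/-- `f` is a Bloch function on the polydisk. -/
def IsBlochPoly (n : ℕ) (f : (Fin n → ℂ) → ℂ) : Prop :=
  DifferentiableOn ℂ f (polydisk n) ∧ BddAbove (blochValuesPoly n f)

/-- The Bloch norm `‖f‖_B = |f(0)| + β_f` on the polydisk. -/
noncomputable def blochNormPoly (n : ℕ) (f : (Fin n → ℂ) → ℂ) : ℝ :=
  ‖f 0‖ + blochSemiPoly n f

lemma normsq_le_polyH {n : ℕ} {z : Fin n → ℂ} (hz : z ∈ polydisk n) (u : Fin n → ℂ) :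
    ‖u‖ ≤ Real.sqrt (polyH n z u) := by
  refine (pi_norm_le_iff_of_nonneg (Real.sqrt_nonneg _)).2 fun k => ?_
  refine Real.le_sqrt_of_sq_le ?_
  have hk : ‖z k‖ < 1 := hz k
  have h0 := norm_nonneg (z k)
  have h1 : 0 < 1 - ‖z k‖ ^ 2 := by nlinarith
  have h2 : (1 - ‖z k‖ ^ 2) ^ 2 ≤ 1 := by nlinarith [sq_nonneg (‖z k‖)]
  calc ‖u k‖ ^ 2 ≤ ‖u k‖ ^ 2 / (1 - ‖z k‖ ^ 2) ^ 2 := by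
        rw [le_div_iff₀ (by positivity)]
        nlinarith [sq_nonneg (‖u k‖)]
    _ ≤ polyH n z u := by
        unfold polyH
        exact Finset.single_le_sum
          (f := fun k => ‖u k‖ ^ 2 / (1 - ‖z k‖ ^ 2) ^ 2)
          (fun i _ => by positivity) (Finset.mem_univ k)

lemma isBloch_iff {n : ℕ} {f : (Fin n → ℂ) → ℂ} :
    IsBlochPoly n f ↔ DifferentiableOn ℂ f (polydisk n) ∧
      ∃ C : ℝ, 0 ≤ C ∧ ∀ z ∈ polydisk n, ∀ u,
        ‖fderiv ℂ f z u‖ ≤ C * Real.sqrt (polyH n z u) := by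
  unfold IsBlochPoly
  refine and_congr_right fun _ => ⟨?_, ?_⟩
  · rintro ⟨C, hC⟩
    refine ⟨max C 0, le_max_right _ _, fun z hz u => ?_⟩
    by_cases hu : u = 0
    · subst hu
      rw [map_zero, norm_zero]
      have := Real.sqrt_nonneg (polyH n z 0)
      have := le_max_right C 0
      positivity
    · have hpos : 0 < Real.sqrt (polyH n z u) :=
        lt_of_lt_of_le (norm_pos_iff.2 hu) (normsq_le_polyH hz u)
      have hb : BddAbove {r : ℝ | ∃ u : Fin n → ℂ, u ≠ 0 ∧
          r = ‖fderiv ℂ f z u‖ / Real.sqrt (polyH n z u)} := by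
        refine ⟨‖fderiv ℂ f z‖, ?_⟩
        rintro r ⟨v, hv, rfl⟩
        refine div_le_of_le_mul₀ (Real.sqrt_nonneg _) (norm_nonneg _) ?_
        exact ((fderiv ℂ f z).le_opNorm v).trans
          (mul_le_mul_of_nonneg_left (normsq_le_polyH hz v) (norm_nonneg _))
      have h1 : ‖fderiv ℂ f z u‖ / Real.sqrt (polyH n z u) ≤ Qpoly n f z :=
        le_csSup hb ⟨u, hu, rfl⟩
      have h2 : Qpoly n f z ≤ C := hC ⟨z, hz, rfl⟩
      rw [← div_le_iff₀ hpos]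
      exact h1.trans (h2.trans (le_max_left _ _))
  · rintro ⟨C, hC0, hC⟩
    refine ⟨C, ?_⟩
    rintro r ⟨z, hz, rfl⟩
    refine Real.sSup_le ?_ hC0
    rintro r ⟨u, hu, rfl⟩
    exact div_le_of_le_mul₀ (Real.sqrt_nonneg _) hC0 (hC z hz u)

lemma isOpen_polydisk (n : ℕ) : IsOpen (polydisk n) := by
  have : polydisk n = ⋂ k, {z : Fin n → ℂ | ‖z k‖ < 1} := by
    ext z; simp [polydisk]
  rw [this]
  exact isOpen_iInter_of_finite fun k =>
    isOpen_lt (continuous_apply k).norm continuous_const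

lemma isBloch_of_contDiff {n : ℕ} {f : (Fin n → ℂ) → ℂ} (hf : ContDiff ℂ 1 f) :
    IsBlochPoly n f := by
  refine isBloch_iff.2 ⟨(hf.differentiable one_ne_zero).differentiableOn, ?_⟩
  have hc : Continuous (fderiv ℂ f) := hf.continuous_fderiv one_ne_zero
  obtain ⟨C, hC⟩ := (isCompact_closedBall (0 : Fin n → ℂ) 1).exists_bound_of_continuousOn
    hc.continuousOn
  have hC0 : 0 ≤ C := (norm_nonneg _).trans (hC 0 (by simp))
  refine ⟨C, hC0, fun z hz u => ?_⟩
  have hz1 : z ∈ closedBall (0 : Fin n → ℂ) 1 := by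
    rw [mem_closedBall_zero_iff]
    exact (pi_norm_le_iff_of_nonneg zero_le_one).2 fun k => (hz k).le
  exact ((fderiv ℂ f z).le_opNorm u).trans
    (mul_le_mul (hC z hz1) (normsq_le_polyH hz u) (norm_nonneg _) hC0)

lemma IsBlochPoly.add' {n : ℕ} {f g : (Fin n → ℂ) → ℂ} (hf : IsBlochPoly n f)
    (hg : IsBlochPoly n g) : IsBlochPoly n (fun z => f z + g z) := by
  rw [isBloch_iff] at *
  obtain ⟨df, C, hC0, hC⟩ := hf
  obtain ⟨dg, D, hD0, hD⟩ := hg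
  refine ⟨df.add dg, C + D, by positivity, fun z hz u => ?_⟩
  have hn := (isOpen_polydisk n).mem_nhds hz
  rw [fderiv_fun_add (df.differentiableAt hn) (dg.differentiableAt hn), add_mul]
  exact (norm_add_le _ _).trans (add_le_add (hC z hz u) (hD z hz u))

lemma IsBlochPoly.const_mul' {n : ℕ} {f : (Fin n → ℂ) → ℂ} (hf : IsBlochPoly n f)
    (c : ℂ) : IsBlochPoly n (fun z => c * f z) := by
  rw [isBloch_iff] at *
  obtain ⟨df, C, hC0, hC⟩ := hf
  refine ⟨df.const_mul c, ‖c‖ * C, by positivity, fun z hz u => ?_⟩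
  have hn := (isOpen_polydisk n).mem_nhds hz
  rw [fderiv_const_mul (df.differentiableAt hn), mul_assoc, smul_apply,
    norm_smul]
  exact mul_le_mul_of_nonneg_left (hC z hz u) (norm_nonneg _)

lemma IsBlochPoly.comp_perm {n : ℕ} {f : (Fin n → ℂ) → ℂ} (hf : IsBlochPoly n f)
    (σ : Equiv.Perm (Fin n)) : IsBlochPoly n (fun z => f (fun i => z (σ i))) := by
  rw [isBloch_iff] at *
  obtain ⟨df, C, hC0, hC⟩ := hf
  let L : (Fin n → ℂ) →L[ℂ] (Fin n → ℂ) :=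
    ContinuousLinearMap.pi fun i => ContinuousLinearMap.proj (σ i)
  have hL : ∀ z, L z = fun i => z (σ i) := fun z => rfl
  have hm : ∀ z ∈ polydisk n, L z ∈ polydisk n := fun z hz k => hz (σ k)
  refine ⟨df.comp L.differentiable.differentiableOn hm, C, hC0, fun z hz u => ?_⟩
  have hn := (isOpen_polydisk n).mem_nhds (hm z hz)
  have h1 : HasFDerivAt (fun z => f (fun i => z (σ i))) ((fderiv ℂ f (L z)).comp L) z :=
    (df.differentiableAt hn).hasFDerivAt.comp z L.hasFDerivAt
  rw [h1.fderiv]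
  have h2 : polyH n z u = polyH n (L z) (L u) := by
    unfold polyH
    exact (Equiv.sum_comp σ (fun k => ‖u k‖ ^ 2 / (1 - ‖z k‖ ^ 2) ^ 2)).symm
  rw [h2]
  exact hC (L z) (hm z hz) (L u)

/-- Partial resolvent sums. -/
noncomputable def resSum {n : ℕ} (τ : Equiv.Perm (Fin n)) (μ : ℂ) (g : (Fin n → ℂ) → ℂ) :
    ℕ → (Fin n → ℂ) → ℂ
  | 0 => fun _ => 0
  | m + 1 => fun z => g (fun i => z ((τ ^ m) i)) + μ * resSum τ μ g m z

lemma resSum_bloch {n : ℕ} (τ : Equiv.Perm (Fin n)) (μ : ℂ) {g : (Fin n → ℂ) → ℂ}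
    (hg : IsBlochPoly n g) (m : ℕ) : IsBlochPoly n (resSum τ μ g m) := by
  induction m with
  | zero => exact isBloch_of_contDiff contDiff_const
  | succ m ih => exact (hg.comp_perm (τ ^ m)).add' (ih.const_mul' μ)

lemma resSum_eq {n : ℕ} (τ : Equiv.Perm (Fin n)) (μ : ℂ) (g : (Fin n → ℂ) → ℂ)
    (m : ℕ) (z : Fin n → ℂ) :
    resSum τ μ g m (fun i => z (τ i)) - μ * resSum τ μ g m z
      = g (fun i => z ((τ ^ m) i)) - μ ^ m * g z := by
  induction m with
  | zero => simp [resSum]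
  | succ m ih =>
    have h : (fun i => z ((τ ^ (m + 1)) i)) = fun i => z (τ ((τ ^ m) i)) := by
      funext i; rw [pow_succ', Equiv.Perm.mul_apply]
    rw [h]
    simp only [resSum]
    linear_combination μ * ih

lemma resSum_of_sol {n : ℕ} (τ : Equiv.Perm (Fin n)) (μ : ℂ) (f g : (Fin n → ℂ) → ℂ)
    (h : ∀ z ∈ polydisk n, f (fun i => z (τ i)) - μ * f z = g z)
    (m : ℕ) (z : Fin n → ℂ) (hz : z ∈ polydisk n) :
    f (fun i => z ((τ ^ m) i)) - μ ^ m * f z = resSum τ μ g m z := by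
  induction m with
  | zero => simp [resSum]
  | succ m ih =>
    have h' : (fun i => z ((τ ^ (m + 1)) i)) = fun i => z ((τ ^ m) (τ i)) := by
      funext i; rw [pow_succ, Equiv.Perm.mul_apply]
    have := h (fun i => z ((τ ^ m) i)) (fun k => hz _)
    rw [h']
    simp only [resSum]
    linear_combination this + μ * ih

lemma exists_bad {n : ℕ} (τ : Equiv.Perm (Fin n)) (μ : ℂ) :
    ∃ g : (Fin n → ℂ) → ℂ, IsBlochPoly n g ∧
      ∃ z ∈ polydisk n, resSum τ μ g (orderOf τ) z ≠ 0 := by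
  obtain ⟨N, hN⟩ : ∃ N, orderOf τ = N + 1 :=
    Nat.exists_eq_succ_of_ne_zero (orderOf_pos τ).ne'
  let z : Fin n → ℂ := fun k => ((1 / ((k : ℝ) + 2) : ℝ) : ℂ)
  have hzD : z ∈ polydisk n := by
    intro k
    have hk : (0 : ℝ) ≤ (k : ℝ) := by positivity
    simp only [z]
    rw [Complex.norm_real, Real.norm_of_nonneg (by positivity), div_lt_one (by positivity)]
    linarith
  have hzi : Function.Injective z := by
    intro a b hab
    have h1 : (1 / ((a : ℝ) + 2) : ℝ) = 1 / ((b : ℝ) + 2) :=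
      Complex.ofReal_injective hab
    have h2 : ((a : ℝ) + 2) = (b : ℝ) + 2 := by
      simpa using h1
    have h3 : (a : ℝ) = (b : ℝ) := by linarith
    exact Fin.ext (by exact_mod_cast h3)
  have hex : ∀ j : Fin N, ∃ i, (τ ^ N) i ≠ (τ ^ (j : ℕ)) i := by
    intro j
    by_contra! hc
    have h1 : τ ^ N = τ ^ (j : ℕ) := Equiv.ext hc
    have h2 := pow_injOn_Iio_orderOf (x := τ) (show N ∈ Set.Iio (orderOf τ) by simp [hN])
      (show (j : ℕ) ∈ Set.Iio (orderOf τ) by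
        have := j.2
        simp only [Set.mem_Iio, hN]; omega) h1
    have := j.2
    omega
  choose c hc using hex
  let g : (Fin n → ℂ) → ℂ := fun w => ∏ j : Fin N, (w (c j) - z ((τ ^ (j : ℕ)) (c j)))
  refine ⟨g, isBloch_of_contDiff ?_, z, hzD, ?_⟩
  · exact contDiff_prod fun j _ => (contDiff_apply ℂ ℂ (c j)).sub contDiff_const
  · have h0 : ∀ m ≤ N, resSum τ μ g m z = 0 := by
      intro m
      induction m with
      | zero => intro _; rfl
      | succ m ih =>
        intro hm
        simp only [resSum]
        rw [ih (by omega), mul_zero, add_zero]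
        exact Finset.prod_eq_zero (Finset.mem_univ (⟨m, by omega⟩ : Fin N)) (sub_self _)
    rw [hN]
    simp only [resSum]
    rw [h0 N le_rfl, mul_zero, add_zero]
    refine Finset.prod_ne_zero_iff.2 fun j _ => ?_
    exact sub_ne_zero.2 fun h => hc j (hzi h)

/-- Let `τ` be a permutation of `{1,…,n}` of order `α` and let
`φ(z) = (z_{τ(1)}, …, z_{τ(n)})`. For `μ ∈ ℂ`, the equation `f ∘ φ − μ f = g`
has a unique Bloch solution `f` for every Bloch `g` if and only if `μ^α ≠ 1`;
in particular, when `μ^α = 1` there is a Bloch `g` for which no Bloch `f`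
solves the equation. -/
theorem resolvent_of_permutation_symbol (n : ℕ) (τ : Equiv.Perm (Fin n))
    (α : ℕ) (hα : orderOf τ = α)
    (φ : (Fin n → ℂ) → Fin n → ℂ)
    (hφ : ∀ z : Fin n → ℂ, ∀ i, φ z i = z (τ i))
    (μ : ℂ) :
    ((∀ g : (Fin n → ℂ) → ℂ, IsBlochPoly n g →
      (∃ f : (Fin n → ℂ) → ℂ, IsBlochPoly n f ∧
        ∀ z ∈ polydisk n, f (φ z) - μ * f z = g z) ∧
      (∀ f₁ f₂ : (Fin n → ℂ) → ℂ, IsBlochPoly n f₁ → IsBlochPoly n f₂ →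
        (∀ z ∈ polydisk n, f₁ (φ z) - μ * f₁ z = g z) →
        (∀ z ∈ polydisk n, f₂ (φ z) - μ * f₂ z = g z) →
        EqOn f₁ f₂ (polydisk n))) ↔ μ ^ α ≠ 1) ∧
    (μ ^ α = 1 → ∃ g : (Fin n → ℂ) → ℂ, IsBlochPoly n g ∧
      ∀ f : (Fin n → ℂ) → ℂ, IsBlochPoly n f →
        ¬ (∀ z ∈ polydisk n, f (φ z) - μ * f z = g z)) := by
  have hφ' : φ = fun z i => z (τ i) := by funext z i; exact hφ z i
  subst hφ' hα
  have hone : ∀ z : Fin n → ℂ, (fun i => z ((τ ^ orderOf τ) i)) = z := by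
    intro z; rw [pow_orderOf_eq_one]; rfl
  have last : μ ^ orderOf τ = 1 → ∃ g : (Fin n → ℂ) → ℂ, IsBlochPoly n g ∧
      ∀ f : (Fin n → ℂ) → ℂ, IsBlochPoly n f →
        ¬ (∀ z ∈ polydisk n, f (fun i => z (τ i)) - μ * f z = g z) := by
    intro hμ
    obtain ⟨g, hg, z, hz, hne⟩ := exists_bad τ μ
    refine ⟨g, hg, fun f _ hsol => hne ?_⟩
    rw [← resSum_of_sol τ μ f g hsol _ z hz, hone, hμ, one_mul, sub_self]
  refine ⟨⟨fun H hμ => ?_, fun hμ g hg => ⟨?_, ?_⟩⟩, last⟩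
  · obtain ⟨g, hg, hno⟩ := last hμ
    obtain ⟨⟨f, hf, hsol⟩, _⟩ := H g hg
    exact hno f hf hsol
  · have hne : (1 - μ ^ orderOf τ) ≠ 0 := sub_ne_zero.2 (Ne.symm hμ)
    refine ⟨fun z => (1 - μ ^ orderOf τ)⁻¹ * resSum τ μ g (orderOf τ) z,
      (resSum_bloch τ μ hg _).const_mul' _, fun z _ => ?_⟩
    have h := resSum_eq τ μ g (orderOf τ) z
    rw [hone] at h
    have h2 : (1 - μ ^ orderOf τ)⁻¹ * (1 - μ ^ orderOf τ) = 1 := inv_mul_cancel₀ hne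
    linear_combination (1 - μ ^ orderOf τ)⁻¹ * h + g z * h2
  · intro f₁ f₂ _ _ h₁ h₂ z hz
    have e₁ := resSum_of_sol τ μ f₁ g h₁ (orderOf τ) z hz
    have e₂ := resSum_of_sol τ μ f₂ g h₂ (orderOf τ) z hz
    rw [hone] at e₁ e₂
    have hne : (1 - μ ^ orderOf τ) ≠ 0 := sub_ne_zero.2 (Ne.symm hμ)
    refine mul_left_cancel₀ hne ?_
    linear_combination e₁ - e₂
end
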